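/- Let h_m(s) = e^{(m+1/2)s} / (e^s + 1)^{m+1} for real s and nonnegative integer m, and let F_m(t) = ∫_{-∞}^{∞} h_m(s) e^{i t s} ds be its Fourier transform. Then for every real u > 0, ∫_{-∞}^{∞} F_m(t) u^{-it} / (e^{π t} + e^{-π t}) dt = u^{-1/2} 𝓛_m(u^{-1}), where 𝓛_m(v) = ∫₀^∞ x^m / ((x+1)^{m+1}(xv+1)) dx. -/

import Mathlib

open Complex

noncomputable def hFun (m : ℕ) (s : ℝ) : ℝ :=
  Real.exp ((m + 1 / 2) * s) / (Real.exp s + 1) ^ (m + 1)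

noncomputable def FFun (m : ℕ) (t : ℝ) : ℂ :=
  ∫ s : ℝ, (hFun m s : ℂ) * Complex.exp (I * t * s)

noncomputable def modLogInt (m : ℕ) (v : ℝ) : ℝ :=
  ∫ x in Set.Ioi (0:ℝ), x ^ m / ((x + 1) ^ (m + 1) * (x * v + 1))

open MeasureTheory

lemma abs_deriv_sigmoid_smul_betaIntegrand (a : ℂ) (y : ℝ) :
    |Real.sigmoid y * (1 - Real.sigmoid y)| •
        ((Real.sigmoid y : ℂ) ^ (a - 1) * (1 - (Real.sigmoid y : ℂ)) ^ ((1 - a) - 1))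
      = exp (a * y) / (exp y + 1) := by
  have hp := Real.sigmoid_pos y
  have hq : 0 < Real.sigmoid (-y) := Real.sigmoid_pos (-y)
  have hy : y = Real.log (Real.sigmoid y) - Real.log (Real.sigmoid (-y)) := by
    rw [← Real.sigmoid_mul_rexp_neg, Real.log_mul hp.ne' (Real.exp_pos _).ne', Real.log_exp]
    ring
  have hden : exp (y : ℂ) + 1 = ((Real.sigmoid (-y) : ℝ) : ℂ)⁻¹ := by
    rw [Real.sigmoid_def]
    push_cast
    rw [neg_neg, inv_inv, add_comm]
  have hsub : (1 : ℂ) - (Real.sigmoid y : ℂ) = ((Real.sigmoid (-y) : ℝ) : ℂ) := by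
    rw [Real.sigmoid_neg]
    push_cast
    rfl
  rw [hden, hsub, ← Real.sigmoid_neg, abs_of_pos (mul_pos hp hq), div_inv_eq_mul, real_smul]
  generalize Real.sigmoid y = p at *
  generalize Real.sigmoid (-y) = q at *
  have hp' : (p : ℂ) = exp (Real.log p : ℂ) := by rw [← ofReal_exp, Real.exp_log hp]
  have hq' : (q : ℂ) = exp (Real.log q : ℂ) := by rw [← ofReal_exp, Real.exp_log hq]
  rw [cpow_def_of_ne_zero (by exact_mod_cast hp.ne'), cpow_def_of_ne_zero (by exact_mod_cast hq.ne'),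
    ← ofReal_log hp.le, ← ofReal_log hq.le, ofReal_mul]
  rw [hp', hq']
  rw [← exp_add, ← exp_add, ← exp_add, ← exp_add, hy]
  congr 1
  push_cast
  ring

lemma integrable_exp_mul_div_exp_add_one {a : ℂ} (h0 : 0 < a.re) (h1 : a.re < 1) :
    Integrable (fun y : ℝ => exp (a * y) / (exp y + 1)) := by
  have hb := betaIntegral_convergent (u := a) (v := 1 - a) h0 (by simpa using h1)
  rw [intervalIntegrable_iff_integrableOn_Ioo_of_le zero_le_one, ← Real.range_sigmoid,
    ← Set.image_univ, integrableOn_image_iff_integrableOn_abs_deriv_smul MeasurableSet.univ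
      (fun x _ => (Real.hasDerivAt_sigmoid x).hasDerivWithinAt) Real.sigmoid_injective.injOn,
    integrableOn_univ] at hb
  simpa only [abs_deriv_sigmoid_smul_betaIntegrand] using hb

lemma integral_exp_mul_div_exp_add_one {a : ℂ} (h0 : 0 < a.re) (h1 : a.re < 1) :
    ∫ y : ℝ, exp (a * y) / (exp y + 1) = Real.pi / sin (Real.pi * a) := by
  rw [← Gamma_mul_Gamma_one_sub,
    Gamma_mul_Gamma_eq_betaIntegral h0 (by simpa using h1), add_sub_cancel, Gamma_one, one_mul,
    betaIntegral, intervalIntegral.integral_of_le zero_le_one, integral_Ioc_eq_integral_Ioo,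
    ← Real.range_sigmoid, ← Set.image_univ,
    integral_image_eq_integral_abs_deriv_smul MeasurableSet.univ
      (fun x _ => (Real.hasDerivAt_sigmoid x).hasDerivWithinAt) Real.sigmoid_injective.injOn,
    setIntegral_univ]
  simp only [abs_deriv_sigmoid_smul_betaIntegrand]

lemma re_half_add_div_two_pi_mul_I (w : ℝ) :
    (1 / 2 + w / (2 * Real.pi) * I : ℂ).re = 1 / 2 := by
  rw [show (1 / 2 + w / (2 * Real.pi) * I : ℂ)
    = ((1 / 2 : ℝ) : ℂ) + ((w / (2 * Real.pi) : ℝ) : ℂ) * I by push_cast; rfl,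
    add_re, re_ofReal_mul, ofReal_re, I_re, mul_zero, add_zero]

lemma exp_half_add_mul_I_div (w t : ℝ) :
    exp ((1 / 2 + w / (2 * Real.pi) * I) * ((2 * Real.pi * t : ℝ) : ℂ)) /
        (exp ((2 * Real.pi * t : ℝ) : ℂ) + 1)
      = exp (I * t * w) / ((Real.exp (Real.pi * t) : ℂ) + (Real.exp (-(Real.pi * t)) : ℂ)) := by
  have hpi : (Real.pi : ℂ) ≠ 0 := by exact_mod_cast Real.pi_ne_zero
  have hnum : exp ((1 / 2 + w / (2 * Real.pi) * I) * ((2 * Real.pi * t : ℝ) : ℂ))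
      = exp (Real.pi * t) * exp (I * t * w) := by
    rw [← exp_add]
    congr 1
    push_cast
    field_simp
  have hden : exp ((2 * Real.pi * t : ℝ) : ℂ) + 1 = exp (Real.pi * t) *
      ((Real.exp (Real.pi * t) : ℂ) + (Real.exp (-(Real.pi * t)) : ℂ)) := by
    push_cast
    rw [mul_add, ← exp_add, ← exp_add, add_neg_cancel, exp_zero]
    congr 2
    ring
  rw [hnum, hden, mul_div_mul_left _ _ (exp_ne_zero _)]

lemma integrable_exp_mul_div_two_cosh (w : ℝ) : Integrable (fun t : ℝ =>
    exp (I * t * w) / ((Real.exp (Real.pi * t) : ℂ) + (Real.exp (-(Real.pi * t)) : ℂ))) := by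
  have h := (integrable_exp_mul_div_exp_add_one (a := 1 / 2 + w / (2 * Real.pi) * I)
    (by rw [re_half_add_div_two_pi_mul_I]; norm_num)
    (by rw [re_half_add_div_two_pi_mul_I]; norm_num)).comp_mul_left' (R := 2 * Real.pi)
    (by positivity)
  simpa only [exp_half_add_mul_I_div] using h

/-- The Fourier transform of `1 / (2 cosh (π t))` is `1 / (2 cosh (w / 2))`. -/
lemma integral_exp_mul_div_two_cosh (w : ℝ) :
    ∫ t : ℝ, exp (I * t * w) / ((Real.exp (Real.pi * t) : ℂ) + (Real.exp (-(Real.pi * t)) : ℂ))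
      = 1 / (exp (w / 2) + exp (-(w / 2))) := by
  have hpi : (Real.pi : ℂ) ≠ 0 := by exact_mod_cast Real.pi_ne_zero
  have h := Measure.integral_comp_mul_left (fun y : ℝ =>
    exp ((1 / 2 + w / (2 * Real.pi) * I) * y) / (exp y + 1)) (2 * Real.pi)
  simp only [exp_half_add_mul_I_div] at h
  rw [h, integral_exp_mul_div_exp_add_one (by rw [re_half_add_div_two_pi_mul_I]; norm_num)
    (by rw [re_half_add_div_two_pi_mul_I]; norm_num)]
  have harg : (Real.pi : ℂ) * (1 / 2 + w / (2 * Real.pi) * I) = w / 2 * I + Real.pi / 2 := by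
    field_simp
    ring
  rw [harg, sin_add_pi_div_two, cos_mul_I, abs_of_pos (by positivity), real_smul, cosh]
  push_cast
  have hne : exp ((w : ℂ) / 2) + exp (-(w / 2)) ≠ 0 := by
    have : 0 < Real.exp (w / 2) + Real.exp (-(w / 2)) := by positivity
    exact_mod_cast this.ne'
  field_simp

lemma integrable_hFun (m : ℕ) : Integrable (fun s => (hFun m s : ℂ)) := by
  refine (integrable_exp_mul_div_exp_add_one (a := 1 / 2) (by simp) (by simp; norm_num)).mono
    ?_ (.of_forall fun s => ?_)
  · have : Continuous (fun s => (hFun m s : ℂ)) := by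
      unfold hFun
      refine continuous_ofReal.comp (Continuous.div (by fun_prop) (by fun_prop) fun s => ?_)
      positivity
    exact this.aestronglyMeasurable
  · have hs : exp ((1 / 2 : ℂ) * s) / (exp s + 1)
        = ((Real.exp (1 / 2 * s) / (Real.exp s + 1) : ℝ) : ℂ) := by
      push_cast
      rfl
    have hle : (Real.exp s) ^ m ≤ (Real.exp s + 1) ^ m := by gcongr; simp
    rw [hs, norm_real, norm_real, Real.norm_of_nonneg (by unfold hFun; positivity),
      Real.norm_of_nonneg (by positivity), hFun, add_mul, Real.exp_add, Real.exp_nat_mul, pow_succ,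
      div_le_div_iff₀ (by positivity) (by positivity)]
    have := mul_le_mul_of_nonneg_right hle
      (show 0 ≤ Real.exp (1 / 2 * s) * (Real.exp s + 1) by positivity)
    linarith

lemma modLogInt_eq_integral_exp (m : ℕ) (v : ℝ) :
    modLogInt m v = ∫ s : ℝ, Real.exp s *
      (Real.exp s ^ m / ((Real.exp s + 1) ^ (m + 1) * (Real.exp s * v + 1))) := by
  rw [modLogInt, ← Real.range_exp, ← Set.image_univ,
    integral_image_eq_integral_abs_deriv_smul MeasurableSet.univ
      (fun x _ => (Real.hasDerivAt_exp x).hasDerivWithinAt) Real.exp_injective.injOn,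
    setIntegral_univ]
  simp only [Real.abs_exp, smul_eq_mul]

lemma hFun_div_two_cosh (m : ℕ) (c s : ℝ) :
    hFun m s * (1 / (Real.exp ((s - c) / 2) + Real.exp (-((s - c) / 2))))
      = Real.exp (-c / 2) * (Real.exp s *
        (Real.exp s ^ m / ((Real.exp s + 1) ^ (m + 1) * (Real.exp s * Real.exp (-c) + 1)))) := by
  have h1 : Real.exp ((m + 1 / 2) * s) = Real.exp s ^ m * Real.exp (s / 2) := by
    rw [← Real.exp_nat_mul, ← Real.exp_add]
    congr 1
    ring
  have h2 : Real.exp s * Real.exp (-c) + 1 = Real.exp (s / 2) * Real.exp (-c / 2) *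
      (Real.exp ((s - c) / 2) + Real.exp (-((s - c) / 2))) := by
    rw [mul_add]
    simp only [← Real.exp_add]
    rw [← Real.exp_zero]
    congr 2 <;> ring
  have h3 : Real.exp s = Real.exp (s / 2) * Real.exp (s / 2) := by
    rw [← Real.exp_add]
    congr 1
    ring
  have hpos : 0 < Real.exp ((s - c) / 2) + Real.exp (-((s - c) / 2)) := by positivity
  rw [hFun, h1, h2]
  generalize Real.exp ((s - c) / 2) + Real.exp (-((s - c) / 2)) = d at *
  have : 0 < Real.exp s + 1 := by positivity
  generalize Real.exp s + 1 = e at *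
  generalize Real.exp s ^ m = k
  rw [h3]
  have := Real.exp_pos (s / 2)
  have := Real.exp_pos (-c / 2)
  field_simp

theorem fourier_modified_log (m : ℕ) (u : ℝ) (hu : 0 < u) :
    ∫ t : ℝ, FFun m t * (u : ℂ) ^ (-(I * t)) / ((Real.exp (Real.pi * t) : ℂ) + (Real.exp (-(Real.pi * t)) : ℂ))
      = (u : ℂ) ^ (-(1:ℂ) / 2) * (modLogInt m u⁻¹ : ℂ) := by
  obtain ⟨c, rfl⟩ : ∃ c, u = Real.exp c := ⟨Real.log u, (Real.exp_log hu).symm⟩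
  have hpow (z : ℂ) : ((Real.exp c : ℝ) : ℂ) ^ z = exp (c * z) := by
    rw [cpow_def_of_ne_zero (by exact_mod_cast (Real.exp_pos c).ne'),
      ← ofReal_log (Real.exp_pos c).le, Real.log_exp]
  have hprod : Integrable (Function.uncurry fun t s : ℝ => exp (I * t * ((s - c : ℝ) : ℂ)) /
      ((Real.exp (Real.pi * t) : ℂ) + (Real.exp (-(Real.pi * t)) : ℂ)) * (hFun m s : ℂ))
      (volume.prod volume) := by
    have h := ((integrable_exp_mul_div_two_cosh 0).mul_prod (integrable_hFun m)).bdd_mul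
      (f := fun p : ℝ × ℝ => exp (I * p.1 * ((p.2 - c : ℝ) : ℂ))) (c := 1)
      (Continuous.aestronglyMeasurable (by fun_prop)) (.of_forall fun p => by
        rw [mul_assoc, ← ofReal_mul, mul_comm, norm_exp_ofReal_mul_I])
    refine h.congr (.of_forall fun p => ?_)
    simp only [Function.uncurry, ofReal_zero, mul_zero, exp_zero]
    ring
  calc _ = ∫ t : ℝ, ∫ s : ℝ, exp (I * t * ((s - c : ℝ) : ℂ)) /
        ((Real.exp (Real.pi * t) : ℂ) + (Real.exp (-(Real.pi * t)) : ℂ)) * (hFun m s : ℂ) := by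
        congr 1 with t
        rw [FFun, mul_div_assoc, ← integral_mul_const]
        congr 1 with s
        have : exp (I * t * ((s - c : ℝ) : ℂ)) = exp (I * t * s) * exp (c * -(I * t)) := by
          rw [← exp_add]
          congr 1
          push_cast
          ring
        rw [hpow, this]
        ring
    _ = ∫ s : ℝ, ((Real.exp (-c / 2) * (Real.exp s *
        (Real.exp s ^ m / ((Real.exp s + 1) ^ (m + 1) * (Real.exp s * Real.exp (-c) + 1)))) : ℝ) :
          ℂ) := by
        rw [integral_integral_swap hprod]
        congr 1 with s
        rw [integral_mul_const, integral_exp_mul_div_two_cosh, ← hFun_div_two_cosh, mul_comm]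
        push_cast
        rfl
    _ = _ := by
        rw [integral_complex_ofReal, integral_const_mul, hpow, modLogInt_eq_integral_exp, ← Real.exp_neg,
          ofReal_mul, ofReal_exp]
        congr 2
        push_cast
        ring
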